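/- Let A be a unital C*-algebra and let a, b ∈ A be core invertible (equivalently, dual core invertible) with a ≠ 0 and b ≠ 0. Then both ‖b⊕ − a⊕‖ and ‖b⊖ − a⊖‖ are at most ‖b† − a†‖ / cos ψ_b + ( ‖a†‖ · ( ‖b†‖ + ‖a†‖ ) / ( cos ψ_a · cos ψ_b ) ) · ‖a − b‖. -/

import Mathlib

open scoped Classical

/-- `x` is a Moore–Penrose inverse of `a`. -/
def IsMPInv {A : Type*} [Ring A] [StarRing A] (a x : A) : Prop :=
  a * x * a = a ∧ x * a * x = x ∧ star (a * x) = a * x ∧ star (x * a) = x * a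

/-- `x` is a group inverse of `a`. -/
def IsGroupInv {A : Type*} [Ring A] (a x : A) : Prop :=
  a * x * a = a ∧ x * a * x = x ∧ a * x = x * a

/-- `x` is a core inverse of `a`: `a·x·a = a`, `x·A = a·A`, `A·x = A·a*`. -/
def IsCoreInv {A : Type*} [Ring A] [StarRing A] (a x : A) : Prop :=
  a * x * a = a ∧ (Set.range fun y => x * y) = (Set.range fun y => a * y) ∧
    (Set.range fun y => y * x) = (Set.range fun y => y * star a)

/-- `x` is a dual core inverse of `a`: `a·x·a = a`, `x·A = a*·A`, `A·x = A·a`. -/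
def IsDualCoreInv {A : Type*} [Ring A] [StarRing A] (a x : A) : Prop :=
  a * x * a = a ∧ (Set.range fun y => x * y) = (Set.range fun y => star a * y) ∧
    (Set.range fun y => y * x) = (Set.range fun y => y * a)

/-- The Moore–Penrose inverse `a†` (or `0` if it does not exist). -/
noncomputable def mpInv {A : Type*} [Ring A] [StarRing A] (a : A) : A :=
  if h : ∃ x, IsMPInv a x then h.choose else 0

/-- The group inverse `a#` (or `0` if it does not exist). -/
noncomputable def groupInv {A : Type*} [Ring A] (a : A) : A :=
  if h : ∃ x, IsGroupInv a x then h.choose else 0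

/-- The core inverse `a⊕` (or `0` if it does not exist). -/
noncomputable def coreInv {A : Type*} [Ring A] [StarRing A] (a : A) : A :=
  if h : ∃ x, IsCoreInv a x then h.choose else 0

/-- The dual core inverse `a⊖` (or `0` if it does not exist). -/
noncomputable def dualCoreInv {A : Type*} [Ring A] [StarRing A] (a : A) : A :=
  if h : ∃ x, IsDualCoreInv a x then h.choose else 0

/-- The maximal angle `ψ_a ∈ [0, π/2]` between `a·a†` and `a†·a`, defined by
`sin ψ_a = ‖a·a† − a†·a‖` (and `ψ_a = 0` when `a = 0`). -/
noncomputable def maxAngle {A : Type*} [NormedRing A] [StarRing A] (a : A) : ℝ :=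
  Real.arcsin ‖a * mpInv a - mpInv a * a‖

/-- `δ(M, N)`: zero if `M = {0}`, otherwise the supremum of distances from
norm-one elements of `M` to `N`. -/
noncomputable def subDelta {E : Type*} [NormedAddCommGroup E] (M N : Set E) : ℝ :=
  if M = {0} then 0
  else sSup ((fun m => Metric.infDist m N) '' {m ∈ M | ‖m‖ = 1})

/-- The gap `θ(M, N)` between the subspaces `M` and `N`. -/
noncomputable def subGap {E : Type*} [NormedAddCommGroup E] (M N : Set E) : ℝ :=
  max (subDelta M N) (subDelta N M)

/-- The right ideal `a·A`. -/
def rIdeal {A : Type*} [Ring A] (a : A) : Set A := Set.range fun y => a * y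

/-- The left ideal `A·a`. -/
def lIdeal {A : Type*} [Ring A] (a : A) : Set A := Set.range fun y => y * a

/-- The right annihilator `a° = {x : a·x = 0}`. -/
def rAnn {A : Type*} [Ring A] (a : A) : Set A := {x | a * x = 0}

/-- The left annihilator `°a = {x : x·a = 0}`. -/
def lAnn {A : Type*} [Ring A] (a : A) : Set A := {x | x * a = 0}

section CStarFacts

variable {A : Type*} [NormedRing A] [StarRing A] [CStarRing A]
  [CompleteSpace A] [NormedAlgebra ℂ A] [StarModule ℂ A]

theorem isUnit_one_add_star_mul_self (t : A) : IsUnit (1 + star t * t) := by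
  let _ : CStarAlgebra A := {}
  let _ : PartialOrder A := CStarAlgebra.spectralOrder A
  have : StarOrderedRing A := CStarAlgebra.spectralOrderedRing A
  exact (isStrictlyPositive_one.add_nonneg (star_mul_self_nonneg t)).isUnit

theorem norm_lt_one_of_isUnit_one_sub_sq {d u v : A} (hd : star d = d)
    (h : 1 - d * d = star u * u + star v * v) (hunit : IsUnit (1 - d * d)) : ‖d‖ < 1 := by
  let _ : CStarAlgebra A := {}
  let _ : PartialOrder A := CStarAlgebra.spectralOrder A
  have : StarOrderedRing A := CStarAlgebra.spectralOrderedRing A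
  rcases subsingleton_or_nontrivial A with hA | hA
  · simp [Subsingleton.elim d 0]
  have hdd : 0 ≤ d * d := by
    have := star_mul_self_nonneg d
    rwa [hd] at this
  have hle : d * d ≤ 1 := by
    rw [← sub_nonneg, h]
    exact add_nonneg (star_mul_self_nonneg u) (star_mul_self_nonneg v)
  have hnorm : ‖d * d‖ = ‖d‖ * ‖d‖ := by
    have := CStarRing.norm_star_mul_self (x := d)
    rwa [hd] at this
  have h1 : ‖d * d‖ ≤ 1 := (CStarAlgebra.norm_le_one_iff_of_nonneg _ hdd).2 hle
  have h2 : ‖d * d‖ ≠ 1 := by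
    intro heq
    have hmem : ‖d * d‖ ∈ spectrum ℝ (d * d) := CStarAlgebra.norm_mem_spectrum_of_nonneg hdd
    rw [heq, spectrum.mem_iff, map_one] at hmem
    exact hmem hunit
  have h3 : ‖d‖ * ‖d‖ < 1 := hnorm ▸ lt_of_le_of_ne h1 h2
  nlinarith [norm_nonneg d]

end CStarFacts

section ObliqueProjections

/-- `e` is the idempotent with the range of the projection `p` and the kernel of the
projection `q`. -/
structure IsObliqueProj {A : Type*} [Ring A] [StarRing A] (p q e : A) : Prop where
  star_p : star p = p
  star_q : star q = q
  mul_p : e * p = p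
  p_mul : p * e = e
  mul_q : e * q = e
  q_mul : q * e = q

namespace IsObliqueProj

variable {A : Type*}

theorem compl [Ring A] [StarRing A] {p q e : A} (h : IsObliqueProj p q e) :
    IsObliqueProj (1 - q) (1 - p) (1 - e) where
  star_p := by simp [h.star_q]
  star_q := by simp [h.star_p]
  mul_p := by simp [mul_sub, sub_mul, h.mul_q]
  p_mul := by simp [mul_sub, sub_mul, h.q_mul]
  mul_q := by simp [mul_sub, sub_mul, h.mul_p]
  q_mul := by simp [mul_sub, sub_mul, h.p_mul]

variable [NormedRing A] [StarRing A] {p q e : A}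

theorem p_mul_p (h : IsObliqueProj p q e) : p * p = p := by
  calc p * p = p * e * p := by rw [mul_assoc, h.mul_p]
    _ = p := by rw [h.p_mul, h.mul_p]

theorem q_mul_q (h : IsObliqueProj p q e) : q * q = q := by
  nth_rw 1 [← h.q_mul]
  rw [mul_assoc, h.mul_q, h.q_mul]

theorem p_mul_star (h : IsObliqueProj p q e) : p * star e = p := by
  simpa [h.star_p] using congrArg star h.mul_p

theorem star_mul_p (h : IsObliqueProj p q e) : star e * p = star e := by
  simpa [h.star_p] using congrArg star h.p_mul

theorem q_mul_star (h : IsObliqueProj p q e) : q * star e = star e := by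
  simpa [h.star_q] using congrArg star h.mul_q

theorem star_mul_q (h : IsObliqueProj p q e) : star e * q = q := by
  simpa [h.star_q] using congrArg star h.q_mul

theorem one_sub_sq (h : IsObliqueProj p q e) :
    1 - (p - q) * (p - q) = p * q * p + (1 - p) * (1 - q) * (1 - p) := by
  simp only [mul_sub, sub_mul, mul_one, one_mul, h.p_mul_p, h.q_mul_q]
  abel

theorem one_sub_sq_mul (h : IsObliqueProj p q e) :
    (1 - (p - q) * (p - q)) * (e * star e + star (1 - e) * (1 - e)) = 1 := by
  have h1 : p * q * p * (e * star e) = p := by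
    calc p * q * p * (e * star e) = p * (q * ((p * e) * star e)) := by simp only [mul_assoc]
      _ = p * ((q * e) * star e) := by rw [h.p_mul, mul_assoc]
      _ = p := by rw [h.q_mul, h.q_mul_star, h.p_mul_star]
  have h2 : (1 - p) * (1 - q) * (1 - p) * (star (1 - e) * (1 - e)) = 1 - p := by
    calc _ = (1 - p) * ((1 - q) * (((1 - p) * star (1 - e)) * (1 - e))) := by
          simp only [mul_assoc]
      _ = (1 - p) * (((1 - q) * star (1 - e)) * (1 - e)) := by
          rw [h.compl.q_mul_star, mul_assoc]
      _ = 1 - p := by rw [h.compl.p_mul_star, h.compl.p_mul, h.compl.q_mul]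
  have h3 : (1 - p) * (e * star e) = 0 := by
    rw [← mul_assoc, sub_mul, h.p_mul, one_mul, sub_self, zero_mul]
  have h4 : p * (star (1 - e) * (1 - e)) = 0 := by
    rw [← mul_assoc, star_sub, star_one, mul_sub p, h.p_mul_star, mul_one, sub_self, zero_mul]
  rw [h.one_sub_sq, add_mul, mul_add, mul_add, h1, h2, mul_assoc (p * q), h4,
    mul_assoc ((1 - p) * (1 - q)) (1 - p) (e * star e), h3]
  simp

theorem isUnit_one_sub_sq (h : IsObliqueProj p q e) : IsUnit (1 - (p - q) * (p - q)) := by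
  refine ⟨⟨_, _, h.one_sub_sq_mul, ?_⟩, rfl⟩
  simpa [h.star_p, h.star_q] using congrArg star h.one_sub_sq_mul

theorem norm_sub_lt_one [CStarRing A] [CompleteSpace A] [NormedAlgebra ℂ A] [StarModule ℂ A]
    (h : IsObliqueProj p q e) : ‖p - q‖ < 1 := by
  refine norm_lt_one_of_isUnit_one_sub_sq (u := q * p) (v := (1 - q) * (1 - p))
    (by simp [h.star_p, h.star_q]) ?_ h.isUnit_one_sub_sq
  have h1 : star (q * p) * (q * p) = p * q * p := by
    rw [star_mul, h.star_p, h.star_q, mul_assoc, ← mul_assoc q, h.q_mul_q, mul_assoc]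
  have h2 : star ((1 - q) * (1 - p)) * ((1 - q) * (1 - p)) = (1 - p) * (1 - q) * (1 - p) := by
    rw [star_mul, h.compl.star_p, h.compl.star_q, mul_assoc, ← mul_assoc (1 - q),
      h.compl.p_mul_p, mul_assoc]
  rw [h1, h2, h.one_sub_sq]

theorem one_sub_sq_mul_norm_sq_le [CStarRing A] (h : IsObliqueProj p q e) :
    (1 - ‖p - q‖ ^ 2) * ‖e‖ ^ 2 ≤ 1 := by
  set x := e * star e with hx
  have hsx : star x = x := by simp [hx]
  have hxp : x * p = x := by rw [hx, mul_assoc, h.star_mul_p]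
  have hpx : p * x = x := by rw [hx, ← mul_assoc, h.p_mul]
  have hxq : x * q * x = x := by
    calc x * q * x = e * (star e * q) * (e * star e) := by simp only [hx, mul_assoc]
      _ = e * ((q * e) * star e) := by rw [h.star_mul_q]; simp only [mul_assoc]
      _ = x := by rw [h.q_mul, h.q_mul_star]
  have key : x * x = x + (x * (p - q)) * star (x * (p - q)) := by
    have e1 : star (x * (p - q)) = (p - q) * x := by simp [hsx, h.star_p, h.star_q]
    have e2 : x * (p - q) = x - x * q := by rw [mul_sub, hxp]
    have e3 : (p - q) * x = x - q * x := by rw [sub_mul, hpx]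
    rw [e1, e2, e3, mul_sub, sub_mul, sub_mul, ← mul_assoc x q x, hxq,
      mul_assoc x q (q * x), ← mul_assoc q q x, h.q_mul_q, ← mul_assoc x q x, hxq]
    abel
  have hn : ‖x‖ = ‖e‖ * ‖e‖ := CStarRing.norm_self_mul_star
  have hnx : ‖x * x‖ = ‖x‖ * ‖x‖ := by
    have := CStarRing.norm_star_mul_self (x := x)
    rwa [hsx] at this
  have hle : ‖x‖ * ‖x‖ ≤ ‖x‖ + (‖x‖ * ‖p - q‖) * (‖x‖ * ‖p - q‖) := by
    rw [← hnx]
    nth_rw 1 [key]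
    refine (norm_add_le _ _).trans (add_le_add le_rfl ?_)
    rw [CStarRing.norm_self_mul_star]
    gcongr <;> exact norm_mul_le _ _
  rcases (norm_nonneg x).eq_or_lt with h0 | hpos
  · have : ‖e‖ ^ 2 = 0 := by rw [sq, ← hn, ← h0]
    rw [this]; norm_num
  · rw [sq ‖e‖, ← hn]
    nlinarith

theorem norm_le [CStarRing A] [CompleteSpace A] [NormedAlgebra ℂ A] [StarModule ℂ A]
    (h : IsObliqueProj p q e) :
    ‖e‖ ≤ (Real.cos (Real.arcsin ‖p - q‖))⁻¹ := by
  have hlt : 0 < 1 - ‖p - q‖ ^ 2 := by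
    nlinarith [h.norm_sub_lt_one, norm_nonneg (p - q)]
  have hs : 0 < √(1 - ‖p - q‖ ^ 2) := Real.sqrt_pos.2 hlt
  rw [Real.cos_arcsin, ← one_div, le_div_iff₀ hs]
  refine abs_le_of_sq_le_sq' ?_ zero_le_one |>.2
  rw [mul_pow, Real.sq_sqrt hlt.le, mul_comm, one_pow]
  exact h.one_sub_sq_mul_norm_sq_le

theorem norm_one_sub_le [CStarRing A] [CompleteSpace A] [NormedAlgebra ℂ A] [StarModule ℂ A]
    (h : IsObliqueProj p q e) :
    ‖1 - e‖ ≤ (Real.cos (Real.arcsin ‖p - q‖))⁻¹ := by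
  have := h.compl.norm_le
  rwa [sub_sub_sub_cancel_left] at this

end IsObliqueProj

/-- Every idempotent of a C⋆-algebra has the same kernel as some self-adjoint projection. -/
theorem exists_selfAdjoint_of_isIdempotentElem {A : Type*} [NormedRing A] [StarRing A] [CStarRing A]
    [CompleteSpace A] [NormedAlgebra ℂ A] [StarModule ℂ A] {e : A} (he : IsIdempotentElem e) :
    ∃ q : A, star q = q ∧ e * q = e ∧ q * e = q := by
  obtain ⟨m, hm⟩ := isUnit_one_add_star_mul_self (e - star e)
  have hee : e * e = e := he
  have hss : star e * star e = star e := by simpa using congrArg star hee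
  have hm' : (m : A) = 1 - e - star e + e * star e + star e * e := by
    rw [hm]
    simp only [star_sub, star_star, mul_sub, sub_mul, hee, hss]
    abel
  have hsm : star (m : A) = m := by
    rw [hm]; simp
  have hem : e * m = e * star e * e := by
    rw [hm']
    simp only [mul_add, mul_sub, mul_one, ← mul_assoc, hee]
    abel
  have hme : m * e = e * star e * e := by
    rw [hm']
    simp only [add_mul, sub_mul, one_mul, mul_assoc, hee]
    abel
  have hc : Commute (m : A) e := hme.trans hem.symm
  have hcs : Commute (m : A) (star e) := by simpa [hsm] using hc.star_star
  have hi : Commute (↑m⁻¹ : A) e := hc.units_inv_left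
  have his : Commute (↑m⁻¹ : A) (star e) := hcs.units_inv_left
  have hsi : star (↑m⁻¹ : A) = ↑m⁻¹ := by
    rw [← Units.coe_star_inv]
    congr 1
    rw [inv_inj]
    exact Units.ext hsm
  refine ⟨star e * e * ↑m⁻¹, ?_, ?_, ?_⟩
  · rw [star_mul, star_mul, star_star, hsi]
    exact (his.mul_right hi).eq
  · rw [← mul_assoc, ← mul_assoc, ← hem, mul_assoc, Units.mul_inv, mul_one]
  · rw [mul_assoc, hi.eq, ← mul_assoc, mul_assoc (star e), hee]

end ObliqueProjections

section CoreInverse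

section Ring

variable {A : Type*} [Ring A] [StarRing A] {a x m y : A}

theorem IsMPInv.mul_eq_of_star_mul_eq (hm : IsMPInv a m) (hx : a * x * a = a)
    (hs : star (a * x) = a * x) : a * x = a * m := by
  have h := congrArg star (show a * m * (a * x) = a * x by rw [← mul_assoc, hm.1])
  rw [star_mul, hs, hm.2.2.1, ← mul_assoc, hx] at h
  exact h.symm

theorem IsMPInv.eq_of_isMPInv (hm : IsMPInv a m) (hx : IsMPInv a x) : x = m := by
  have h1 : a * x = a * m := hm.mul_eq_of_star_mul_eq hx.1 hx.2.2.1
  have h2 : x * a = m * a := by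
    have h := congrArg star (show x * a * (m * a) = x * a by rw [mul_assoc, ← mul_assoc a, hm.1])
    rw [star_mul, hx.2.2.2, hm.2.2.2, mul_assoc, ← mul_assoc a, hx.1] at h
    exact h.symm
  rw [← hx.2.1, h2, mul_assoc, h1, ← mul_assoc, hm.2.1]

theorem IsMPInv.mpInv_eq (hm : IsMPInv a m) : mpInv a = m := by
  have h : ∃ x, IsMPInv a x := ⟨m, hm⟩
  rw [mpInv, dif_pos h]
  exact hm.eq_of_isMPInv h.choose_spec

theorem IsMPInv.star (hm : IsMPInv a m) : IsMPInv (star a) (star m) := by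
  obtain ⟨h1, h2, h3, h4⟩ := hm
  refine ⟨?_, ?_, ?_, ?_⟩
  · simpa [mul_assoc] using congrArg Star.star h1
  · simpa [mul_assoc] using congrArg Star.star h2
  · simpa using h4.symm
  · simpa using h3.symm

namespace IsCoreInv

theorem mul_mul_self (h : IsCoreInv a x) : a * x * x = x := by
  obtain ⟨u, hu⟩ : x ∈ Set.range fun y => a * y := h.2.1 ▸ ⟨1, mul_one x⟩
  dsimp only at hu
  nth_rw 2 [← hu]
  rw [← mul_assoc, h.1, hu]

theorem mul_star_mul (h : IsCoreInv a x) : x * star (a * x) = x := by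
  obtain ⟨v, hv⟩ : x ∈ Set.range fun y => y * star a := h.2.2 ▸ ⟨1, one_mul x⟩
  dsimp only at hv
  nth_rw 1 [← hv]
  rw [mul_assoc, ← star_mul, h.1, hv]

theorem star_mul_eq (h : IsCoreInv a x) : star (a * x) = a * x := by
  have h1 : a * x * star (a * x) = a * x := by rw [mul_assoc, h.mul_star_mul]
  rw [← h1]
  simp

theorem mul_mul_cancel (h : IsCoreInv a x) : x * a * x = x := by
  rw [mul_assoc, ← h.star_mul_eq, h.mul_star_mul]

theorem mul_self_mul (h : IsCoreInv a x) : x * a * a = a := by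
  obtain ⟨w, hw⟩ : a ∈ Set.range fun y => x * y := h.2.1 ▸ ⟨1, mul_one a⟩
  dsimp only at hw
  nth_rw 2 [← hw]
  rw [← mul_assoc, h.mul_mul_cancel, hw]

theorem eq_mul_mpInv (h : IsCoreInv a x) (hm : IsMPInv a m) : x = x * a * m := by
  rw [mul_assoc, ← hm.mul_eq_of_star_mul_eq h.1 h.star_mul_eq, ← mul_assoc, h.mul_mul_cancel]

theorem isObliqueProj (h : IsCoreInv a x) (hm : IsMPInv a m) :
    IsObliqueProj (a * m) (m * a) (x * a) where
  star_p := hm.2.2.1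
  star_q := hm.2.2.2
  mul_p := by rw [← mul_assoc, h.mul_self_mul]
  p_mul := by
    rw [← hm.mul_eq_of_star_mul_eq h.1 h.star_mul_eq, ← mul_assoc, h.mul_mul_self]
  mul_q := by rw [mul_assoc, ← mul_assoc a, hm.1]
  q_mul := by rw [mul_assoc, ← mul_assoc a, h.1]

theorem isDualCoreInv (h : IsCoreInv a x) (hm : IsMPInv a m) :
    IsDualCoreInv a (m * (x * a)) := by
  have hP := h.isObliqueProj hm
  have hmx : a * (m * (x * a)) = x * a := by rw [← mul_assoc, hP.p_mul]
  have hya : m * (x * a) * a = m * a := by rw [mul_assoc, h.mul_self_mul]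
  refine ⟨by rw [hmx, h.mul_self_mul], Set.Subset.antisymm ?_ ?_, Set.Subset.antisymm ?_ ?_⟩
  · rintro _ ⟨y, rfl⟩
    refine ⟨star m * (m * (x * a)) * y, ?_⟩
    simp only [← mul_assoc]
    rw [← star_mul, hm.2.2.2, hm.2.1]
  · rintro _ ⟨y, rfl⟩
    refine ⟨a * (star a * y), ?_⟩
    dsimp only
    rw [← mul_assoc, hya, ← mul_assoc, ← hm.2.2.2, ← star_mul, ← mul_assoc, hm.1]
  · rintro _ ⟨y, rfl⟩
    exact ⟨y * (m * x), by simp only [mul_assoc]⟩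
  · rintro _ ⟨y, rfl⟩
    refine ⟨y * (a * a), ?_⟩
    simp only [mul_assoc]
    rw [hmx, ← mul_assoc a x, h.1]

end IsCoreInv

theorem IsDualCoreInv.star (h : IsDualCoreInv a y) : IsCoreInv (star a) (star y) := by
  obtain ⟨h1, h2, h3⟩ := h
  have range_star_mul (u v : A) (huv : (Set.range fun z => z * u) ⊆ Set.range fun z => z * v) :
      (Set.range fun z => Star.star u * z) ⊆ Set.range fun z => Star.star v * z := by
    rintro _ ⟨z, rfl⟩
    obtain ⟨w, hw⟩ := huv ⟨Star.star z, rfl⟩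
    exact ⟨Star.star w, by simpa using congrArg Star.star hw⟩
  have range_mul_star (u v : A) (huv : (Set.range fun z => u * z) ⊆ Set.range fun z => v * z) :
      (Set.range fun z => z * Star.star u) ⊆ Set.range fun z => z * Star.star v := by
    rintro _ ⟨z, rfl⟩
    obtain ⟨w, hw⟩ := huv ⟨Star.star z, rfl⟩
    exact ⟨Star.star w, by simpa using congrArg Star.star hw⟩
  refine ⟨by simpa [mul_assoc] using congrArg Star.star h1, ?_, ?_⟩
  · exact (range_star_mul _ _ h3.le).antisymm (range_star_mul _ _ h3.ge)
  · exact (range_mul_star _ _ h2.le).antisymm (range_mul_star _ _ h2.ge)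

theorem IsDualCoreInv.eq_mpInv_mul (h : IsDualCoreInv a y) (hx : IsCoreInv a x)
    (hm : IsMPInv a m) : y = m * (x * a) := by
  have h1 : y = m * (a * y) := by
    simpa using congrArg Star.star (h.star.eq_mul_mpInv hm.star)
  have h2 : a * (a * y) = a := by
    simpa [mul_assoc] using congrArg Star.star h.star.mul_self_mul
  have h3 : x * a = a * y := by
    nth_rw 1 [← h2]
    rw [← mul_assoc, ← mul_assoc, hx.mul_self_mul]
  rw [h3, ← h1]

end Ring

theorem norm_sub_le_of_isObliqueProj {A : Type*} [NormedRing A] [StarRing A]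
    {a b m n e f : A} {c d : ℝ}
    (he : IsObliqueProj (a * m) (m * a) e) (hf : IsObliqueProj (b * n) (n * b) f)
    (hae : a * e = a) (hbf : b * f = b) (hec : ‖e‖ ≤ c) (hec' : ‖1 - e‖ ≤ c)
    (hfd : ‖f‖ ≤ d) (hfd' : ‖1 - f‖ ≤ d) :
    ‖f - e‖ ≤ (‖n‖ + ‖m‖) * (c * d) * ‖a - b‖ := by
  have hc : 0 ≤ c := (norm_nonneg _).trans hec
  have hd : 0 ≤ d := (norm_nonneg _).trans hfd
  have h1 : f * n * (b - a) * (1 - e) = f * (1 - e) := by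
    have : (b - a) * (1 - e) = b * (1 - e) := by simp [mul_sub, sub_mul, hae]
    rw [mul_assoc, this, ← mul_assoc, mul_assoc f, hf.mul_q]
  have h2 : (1 - f) * (a - b) * m * e = (1 - f) * e := by
    have hbnb : b * n * b = b := by
      nth_rw 1 [← hbf]
      rw [mul_assoc (b * f), mul_assoc b f, hf.mul_q, hbf]
    have hfb : f * b = b := by
      nth_rw 1 [← hbnb]
      rw [← mul_assoc, hf.mul_p, hbnb]
    have : (1 - f) * (a - b) = (1 - f) * a := by simp [mul_sub, sub_mul, hfb]
    rw [this, mul_assoc (1 - f) a, mul_assoc (1 - f), he.p_mul]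
  have key : f - e = f * n * (b - a) * (1 - e) - (1 - f) * (a - b) * m * e := by
    rw [h1, h2]; noncomm_ring
  rw [key]
  calc _ ≤ ‖f * n * (b - a) * (1 - e)‖ + ‖(1 - f) * (a - b) * m * e‖ := norm_sub_le _ _
    _ ≤ d * ‖n‖ * ‖a - b‖ * c + d * ‖a - b‖ * ‖m‖ * c := by
        gcongr
        · refine (norm_mul_le_of_le (norm_mul_le_of_le (norm_mul_le_of_le hfd le_rfl)
            (norm_sub_rev b a).le) hec')
        · exact norm_mul_le_of_le (norm_mul_le_of_le (norm_mul_le_of_le hfd' le_rfl) le_rfl) hec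
    _ = _ := by ring

variable {A : Type*} [NormedRing A] [StarRing A] [CStarRing A]
  [CompleteSpace A] [NormedAlgebra ℂ A] [StarModule ℂ A] {a x : A}

theorem IsCoreInv.exists_isMPInv (h : IsCoreInv a x) : ∃ m, IsMPInv a m := by
  have he : IsIdempotentElem (x * a) := by
    rw [IsIdempotentElem, ← mul_assoc, h.mul_mul_cancel]
  obtain ⟨q, hq, heq, hqe⟩ := exists_selfAdjoint_of_isIdempotentElem he
  have haq : a * q = a := by
    nth_rw 1 [← h.1]
    rw [mul_assoc a, mul_assoc a, heq, ← mul_assoc, h.1]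
  have hqa : q * x * a = q := by rw [mul_assoc, hqe]
  have haqx : a * (q * x) = a * x := by rw [← mul_assoc, haq]
  refine ⟨q * x, by rw [haqx, h.1], ?_, by rw [haqx, h.star_mul_eq], by rw [hqa, hq]⟩
  rw [mul_assoc, haqx, mul_assoc, ← mul_assoc x, h.mul_mul_cancel]

/-- Joint description of the core, dual core and Moore–Penrose inverses of a core invertible
element in terms of the idempotent `e = a# * a`. -/
theorem exists_isObliqueProj_of_isCoreInv (h : ∃ x, IsCoreInv a x) :
    ∃ e, IsObliqueProj (a * mpInv a) (mpInv a * a) e ∧ a * e = a ∧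
      coreInv a = e * mpInv a ∧ dualCoreInv a = mpInv a * e := by
  have hc : IsCoreInv a (coreInv a) := by
    rw [coreInv, dif_pos h]
    exact h.choose_spec
  obtain ⟨m, hm⟩ := hc.exists_isMPInv
  have hd : IsDualCoreInv a (dualCoreInv a) := by
    have h' : ∃ y, IsDualCoreInv a y := ⟨_, hc.isDualCoreInv hm⟩
    rw [dualCoreInv, dif_pos h']
    exact h'.choose_spec
  rw [hm.mpInv_eq]
  exact ⟨coreInv a * a, hc.isObliqueProj hm, by rw [← mul_assoc, hc.1], hc.eq_mul_mpInv hm,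
    hd.eq_mpInv_mul hc hm⟩

end CoreInverse

theorem stmt11 {A : Type*} [NormedRing A] [StarRing A] [CStarRing A]
    [CompleteSpace A] [NormedAlgebra ℂ A] [StarModule ℂ A]
    (a b : A) (ha : ∃ x, IsCoreInv a x) (hb : ∃ x, IsCoreInv b x)
    (ha0 : a ≠ 0) (hb0 : b ≠ 0) :
    ‖coreInv b - coreInv a‖ ≤
      ‖mpInv b - mpInv a‖ / Real.cos (maxAngle b) +
        ‖mpInv a‖ * (‖mpInv b‖ + ‖mpInv a‖) /
          (Real.cos (maxAngle a) * Real.cos (maxAngle b)) * ‖a - b‖ ∧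
    ‖dualCoreInv b - dualCoreInv a‖ ≤
      ‖mpInv b - mpInv a‖ / Real.cos (maxAngle b) +
        ‖mpInv a‖ * (‖mpInv b‖ + ‖mpInv a‖) /
          (Real.cos (maxAngle a) * Real.cos (maxAngle b)) * ‖a - b‖ := by
  obtain ⟨e, he, hae, hac, had⟩ := exists_isObliqueProj_of_isCoreInv ha
  obtain ⟨f, hf, hbf, hbc, hbd⟩ := exists_isObliqueProj_of_isCoreInv hb
  have hdiff := norm_sub_le_of_isObliqueProj he hf hae hbf he.norm_le he.norm_one_sub_le
    hf.norm_le hf.norm_one_sub_le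
  have hfle : ‖f‖ ≤ (Real.cos (maxAngle b))⁻¹ := hf.norm_le
  have hbound : ‖mpInv b - mpInv a‖ * (Real.cos (maxAngle b))⁻¹ + ‖mpInv a‖ * ‖f - e‖ ≤
      ‖mpInv b - mpInv a‖ / Real.cos (maxAngle b) +
        ‖mpInv a‖ * (‖mpInv b‖ + ‖mpInv a‖) /
          (Real.cos (maxAngle a) * Real.cos (maxAngle b)) * ‖a - b‖ := by
    refine add_le_add (div_eq_mul_inv _ _).ge
      ((mul_le_mul_of_nonneg_left hdiff (norm_nonneg _)).trans_eq ?_)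
    simp only [maxAngle, div_eq_mul_inv, mul_inv]
    ring
  refine ⟨le_trans ?_ hbound, le_trans ?_ hbound⟩
  · have h : coreInv b - coreInv a = f * (mpInv b - mpInv a) + (f - e) * mpInv a := by
      rw [hac, hbc]; noncomm_ring
    rw [h]
    refine (norm_add_le _ _).trans (add_le_add ?_ ?_)
    · rw [mul_comm]
      exact norm_mul_le_of_le hfle le_rfl
    · rw [mul_comm]
      exact norm_mul_le _ _
  · have h : dualCoreInv b - dualCoreInv a =
        (mpInv b - mpInv a) * f + mpInv a * (f - e) := by
      rw [had, hbd]; noncomm_ring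
    rw [h]
    exact (norm_add_le _ _).trans (add_le_add (norm_mul_le_of_le le_rfl hfle) (norm_mul_le _ _))
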